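/- Fix r > 0 and M > √π/(2√r). Then the equation √(2r)·(M − z)·F(√(2r)·z) − Ψ(√(2r)·z) = 0 has exactly one solution z in (0, ∞), and this solution satisfies 0 < z < M/2. -/

import Mathlib

/-- The standard normal density `φ(z) = exp(-z²/2)/√(2π)`. -/
noncomputable def npdf (z : ℝ) : ℝ := (Real.sqrt (2 * Real.pi))⁻¹ * Real.exp (-z ^ 2 / 2)

/-- The standard normal distribution function `Φ(y) = ∫_{-∞}^y φ(z) dz`. -/
noncomputable def ncdf (y : ℝ) : ℝ := ∫ z in Set.Iic y, npdf z

/-- The standard normal tail function `Ψ(y) = 1 - Φ(y)`. -/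
noncomputable def ntail (y : ℝ) : ℝ := 1 - ncdf y

/-- The function `F(y) = φ(y) - y·Ψ(y)`. -/
noncomputable def Fstat (y : ℝ) : ℝ := npdf y - y * ntail y

open Filter Topology MeasureTheory

lemma npdf_eq : npdf = ProbabilityTheory.gaussianPDFReal 0 1 := by
  funext z
  simp [npdf, ProbabilityTheory.gaussianPDFReal]

lemma npdf_int : Integrable npdf := by
  rw [npdf_eq]; exact ProbabilityTheory.integrable_gaussianPDFReal 0 1

lemma npdf_integral : ∫ z, npdf z = 1 := by
  rw [npdf_eq]; exact ProbabilityTheory.integral_gaussianPDFReal_eq_one 0 one_ne_zero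

lemma npdf_pos (z : ℝ) : 0 < npdf z := by
  unfold npdf; have := Real.pi_pos; positivity

lemma npdf_deriv (z : ℝ) : HasDerivAt npdf (-z * npdf z) z := by
  unfold npdf
  have h : HasDerivAt (fun z : ℝ => -z ^ 2 / 2) (-z) z := by
    have := ((hasDerivAt_pow 2 z).neg.div_const 2)
    convert! this using 1
    push_cast; ring
  convert! (h.exp.const_mul (Real.sqrt (2 * Real.pi))⁻¹) using 1
  ring

lemma npdf_cont : Continuous npdf := by
  unfold npdf; fun_prop

lemma npdf_tendsto : Tendsto npdf atTop (𝓝 0) := by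
  unfold npdf
  have h : Tendsto (fun z : ℝ => -z ^ 2 / 2) atTop atBot := by
    have h1 : Tendsto (fun z : ℝ => z ^ 2 / 2) atTop atTop :=
      (tendsto_pow_atTop two_ne_zero).atTop_div_const two_pos
    refine (tendsto_neg_atTop_atBot.comp h1).congr fun z => ?_
    simp [neg_div]
  have := (Real.tendsto_exp_atBot.comp h).const_mul (Real.sqrt (2 * Real.pi))⁻¹
  simpa using this

lemma ntail_deriv (y : ℝ) : HasDerivAt ntail (-npdf y) y := by
  have h : ntail = fun y => 1 - (ncdf 0 + ∫ z in (0:ℝ)..y, npdf z) := by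
    funext y
    rw [← intervalIntegral.integral_Iic_sub_Iic npdf_int.integrableOn npdf_int.integrableOn]
    unfold ntail ncdf
    ring
  rw [h]
  have := (npdf_cont.integral_hasStrictDerivAt 0 y).hasDerivAt
  exact (this.const_add _).const_sub 1

lemma ntail_tendsto : Tendsto ntail atTop (𝓝 0) := by
  have := (aecover_Iic (μ := (volume : Measure ℝ))
    (tendsto_id (α := ℝ) (x := atTop))).integral_tendsto_of_countably_generated npdf_int
  rw [npdf_integral] at this
  have h2 := this.const_sub 1
  rw [sub_self] at h2
  exact h2

lemma ntail_zero : ntail 0 = 1 / 2 := by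
  have h1 := intervalIntegral.integral_Iic_add_Ioi (b := (0:ℝ)) npdf_int.integrableOn
    npdf_int.integrableOn
  rw [npdf_integral] at h1
  have h2 := integral_comp_neg_Iic (0:ℝ) npdf
  have h3 : ∀ x, npdf (-x) = npdf x := fun x => by simp [npdf]
  simp only [h3, neg_zero] at h2
  unfold ntail ncdf
  linarith

lemma pos_of_anti {f f' : ℝ → ℝ} {a : ℝ} (hd : ∀ x, a ≤ x → HasDerivAt f (f' x) x)
    (hn : ∀ x, a ≤ x → f' x < 0) (ht : Tendsto f atTop (𝓝 0)) : 0 < f a := by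
  have hs : StrictAntiOn f (Set.Ici a) := by
    apply strictAntiOn_of_deriv_neg (convex_Ici a)
    · intro x hx; exact (hd x hx).continuousAt.continuousWithinAt
    · intro x hx
      rw [interior_Ici] at hx
      rw [(hd x (le_of_lt hx)).deriv]; exact hn x (le_of_lt hx)
  have h1 : f (a + 1) < f a := hs (by simp) (by simp) (by simp)
  have h2 : 0 ≤ f (a + 1) := by
    refine le_of_tendsto ht ?_
    filter_upwards [eventually_ge_atTop (a + 1)] with x hx
    exact hs.antitoneOn (by simp) (by simp; linarith) hx
  linarith

lemma mills_lower (y : ℝ) : 0 < ntail y - npdf y * (y / (1 + y ^ 2)) := by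
  refine pos_of_anti (f := fun y => ntail y - npdf y * (y / (1 + y ^ 2)))
    (f' := fun y => -2 * npdf y / (1 + y ^ 2) ^ 2) (a := y) ?_ ?_ ?_
  · intro x _
    have hx : (1 + x ^ 2) ≠ 0 := by positivity
    have h1 : HasDerivAt (fun y : ℝ => 1 + y ^ 2) (2 * x) x := by
      simpa using (hasDerivAt_pow 2 x).const_add 1
    convert! (ntail_deriv x).sub ((npdf_deriv x).mul ((hasDerivAt_id x).div h1 hx)) using 1
    simp only [id, Pi.div_apply]
    field_simp
    ring
  · intro x _
    have := npdf_pos x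
    have : 0 < 2 * npdf x / (1 + x ^ 2) ^ 2 := by positivity
    rw [neg_mul, neg_div]; linarith
  · have : Tendsto (fun y => npdf y * (y / (1 + y ^ 2))) atTop (𝓝 0) := by
      refine squeeze_zero_norm (fun x => ?_) npdf_tendsto
      rw [norm_mul, Real.norm_of_nonneg (npdf_pos x).le]
      refine mul_le_of_le_one_right (npdf_pos x).le ?_
      rw [Real.norm_eq_abs, abs_div, abs_of_pos (by positivity : 0 < 1 + x ^ 2),
        div_le_one (by positivity)]
      rw [← sq_abs x]; nlinarith [sq_nonneg (|x| - 1), abs_nonneg x]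
    simpa using ntail_tendsto.sub this

lemma ntail_pos {y : ℝ} (hy : 0 ≤ y) : 0 < ntail y := by
  have h := mills_lower y
  have : 0 ≤ npdf y * (y / (1 + y ^ 2)) := mul_nonneg (npdf_pos y).le (by positivity)
  linarith

lemma Fstat_pos {y : ℝ} (hy : 0 ≤ y) : 0 < Fstat y := by
  rcases hy.eq_or_lt with rfl | hy
  · simpa [Fstat] using npdf_pos 0
  have h : 0 < npdf y / y - ntail y := by
    refine pos_of_anti (f := fun y => npdf y / y - ntail y)
      (f' := fun y => - (npdf y / y ^ 2)) (a := y) ?_ ?_ ?_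
    · intro x hx
      have hx : x ≠ 0 := by linarith [hy.trans_le hx] |> fun h : 0 < x => h.ne'
      convert! ((npdf_deriv x).div (hasDerivAt_id x) hx).sub (ntail_deriv x) using 1
      simp only [id]
      field_simp
      ring
    · intro x hx
      have := npdf_pos x
      have : 0 < x := hy.trans_le hx
      have : 0 < npdf x / x ^ 2 := by positivity
      linarith
    · simpa using (npdf_tendsto.div_atTop tendsto_id).sub ntail_tendsto
  have h2 := mul_pos hy h
  unfold Fstat
  have : y * (npdf y / y - ntail y) = npdf y - y * ntail y := by field_simp
  linarith

lemma Fstat_deriv (y : ℝ) : HasDerivAt Fstat (-ntail y) y := by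
  convert! (npdf_deriv y).sub ((hasDerivAt_id y).mul (ntail_deriv y)) using 1
  simp only [id]; ring

lemma ntail_gt (y : ℝ) : y * Fstat y < ntail y := by
  have h := mills_lower y
  have hp : 0 < 1 + y ^ 2 := by positivity
  have h2 := mul_pos hp h
  have : (1 + y ^ 2) * (ntail y - npdf y * (y / (1 + y ^ 2)))
    = (1 + y ^ 2) * ntail y - npdf y * y := by field_simp
  unfold Fstat
  nlinarith

lemma h_mono : StrictMonoOn (fun y => y + ntail y / Fstat y) (Set.Ici 0) := by
  have hd : ∀ x, 0 ≤ x → HasDerivAt (fun y => y + ntail y / Fstat y)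
      (ntail x * (ntail x - x * Fstat x) / Fstat x ^ 2) x := by
    intro x hx
    have hF := (Fstat_pos hx).ne'
    convert! (hasDerivAt_id x).add ((ntail_deriv x).div (Fstat_deriv x) hF) using 1
    have hn : npdf x = Fstat x + x * ntail x := by unfold Fstat; ring
    rw [hn]
    field_simp
    ring
  apply strictMonoOn_of_deriv_pos (convex_Ici 0)
  · intro x hx; exact (hd x hx).continuousAt.continuousWithinAt
  · intro x hx
    rw [interior_Ici] at hx
    have hx : 0 ≤ x := le_of_lt hx
    rw [(hd x hx).deriv]
    have := Fstat_pos hx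
    have := ntail_pos hx
    have := sub_pos.2 (ntail_gt x)
    positivity


/-- for r > 0 and M > √π/(2√r), the equation
√(2r)·(M−z)·F(√(2r)·z) − Ψ(√(2r)·z) = 0 has exactly one positive solution,
and this solution lies in (0, M/2). -/
theorem unique_root (r M : ℝ) (hr : 0 < r)
    (hM : Real.sqrt Real.pi / (2 * Real.sqrt r) < M) :
    (∃! z : ℝ, 0 < z ∧
      Real.sqrt (2*r) * (M - z) * Fstat (Real.sqrt (2*r) * z)
        - ntail (Real.sqrt (2*r) * z) = 0) ∧
    (∀ z : ℝ, 0 < z →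
      Real.sqrt (2*r) * (M - z) * Fstat (Real.sqrt (2*r) * z)
        - ntail (Real.sqrt (2*r) * z) = 0 → z < M / 2) := by

  have hs : 0 < Real.sqrt (2 * r) := by positivity
  set s := Real.sqrt (2 * r) with hsd
  have hA : Real.sqrt (2 * Real.pi) / 2 < s * M := by
    have h1 := mul_lt_mul_of_pos_left hM hs
    have hr' : 0 < Real.sqrt r := Real.sqrt_pos.2 hr
    have h2 : s * (Real.sqrt Real.pi / (2 * Real.sqrt r)) = Real.sqrt (2 * Real.pi) / 2 := by
      rw [hsd, Real.sqrt_mul (by norm_num), Real.sqrt_mul (by norm_num)]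
      field_simp
    rwa [h2] at h1
  have hM0 : 0 < M := lt_of_le_of_lt (by positivity) hM
  have key : ∀ z : ℝ, 0 < z → s * (M - z) * Fstat (s * z) - ntail (s * z) = 0 →
      s * z + ntail (s * z) / Fstat (s * z) = s * M := by
    intro z hz h
    have hF := (Fstat_pos (mul_pos hs hz).le).ne'
    field_simp
    linarith
  refine ⟨?_, ?_⟩
  · have hc : ContinuousOn (fun z => s * (M - z) * Fstat (s * z) - ntail (s * z))
        (Set.Icc 0 M) := by
      have c1 : Continuous Fstat := continuous_iff_continuousAt.2 fun x =>
        (Fstat_deriv x).continuousAt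
      have c2 : Continuous ntail := continuous_iff_continuousAt.2 fun x =>
        (ntail_deriv x).continuousAt
      fun_prop
    have h0 : 0 < s * (M - 0) * Fstat (s * 0) - ntail (s * 0) := by
      have hp : 0 < Real.sqrt (2 * Real.pi) := by have := Real.pi_pos; positivity
      have hF : Fstat 0 = (Real.sqrt (2 * Real.pi))⁻¹ := by simp [Fstat, npdf]
      rw [mul_zero, sub_zero, ntail_zero, hF, sub_pos, ← div_eq_mul_inv, lt_div_iff₀ hp]
      linarith
    have h1 : s * (M - M) * Fstat (s * M) - ntail (s * M) < 0 := by
      have := ntail_pos (mul_pos hs hM0).le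
      simp [this]
    obtain ⟨z, hz, hz0⟩ := intermediate_value_Ioo' hM0.le hc ⟨h1, h0⟩
    refine ⟨z, ⟨hz.1, hz0⟩, ?_⟩
    rintro w ⟨hw, hw0⟩
    have := h_mono.injOn (mul_pos hs hw).le (mul_pos hs hz.1).le
      ((key w hw hw0).trans (key z hz.1 hz0).symm)
    exact mul_left_cancel₀ hs.ne' this
  · intro z hz h
    have hk := ntail_gt (s * z)
    have hF := Fstat_pos (mul_pos hs hz).le
    have h2 : (s * z) * Fstat (s * z) < (s * (M - z)) * Fstat (s * z) := by linarith
    have h3 := lt_of_mul_lt_mul_right h2 hF.le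
    have h4 := lt_of_mul_lt_mul_left h3 hs.le
    linarith
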